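/- arXiv:1005.1767 — 2 statements merged into one kernel-verified Lean document; each statement's English description precedes it below -/
import Mathlib

section
/- Define, for an integer m and a complex number c, the complex numbers: xi_0 = -2284800 * C(m+14,17) / ((m+1)(m+11)(m+13)); zeta_0 = 152320*(m^3+30m^2+437m+2628) * C(m+14,17) / ((m+1)(m+3)(m+11)(m+13)) - (3168931 m^3 + 41305158 m^2 - 26765899 m - 366373782) * C(m+14,16) * c / ((m+2)(m+3)(m+13)); xi_1 = -17821440 * C(m+14,17) / ((m+5)(m+7)(m+13)); zeta_1 = (8/(5*13!)) * (13 m^6 + 559 m^5 + 10914 m^4 + 113042 m^3 + 541013 m^2 + 743199 m + 141660) * (m-2) * m * (m+2) * (m+4) * (m+6) * (m+7) * (m+8) * (m+10) * (m+12) * (m+14) - 15*(1595885 m^3 + 18046170 m^2 - 32028341 m - 411762282) * C(m+14,16) * c / ((m+2)(m+5)(m+11)); xi_2 = -18670080 * C(m+14,17) / ((m+3)(m+9)(m+13)); zeta_2 = (32/15!) * (143 m^6 + 6435 m^5 + 129602 m^4 + 1390950 m^3 + 7149347 m^2 + 12054375 m + 5315868) * (m-2) * m * (m+2) * (m+4)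 * (m+5) * (m+6) * (m+8) * (m+10) * (m+12) * (m+14) - 156*(152331 m^3 + 1559062 m^2 - 4454319 m - 55321438) * C(m+14,16) * c / ((m+2)(m+7)(m+9)), where C(a,b) denotes the binomial coefficient. Then for every even integer m >= 32 and every complex number c, at least one of the three determinants xi_0*zeta_1 - xi_1*zeta_0, xi_1*zeta_2 - xi_2*zeta_1, xi_2*zeta_0 - xi_0*zeta_2 is nonzero. -/
/-- `ξ₀(m)`. -/
noncomputable def xi0 (m : ℤ) : ℂ :=
  -2284800 * ((m + 14).toNat.choose 17 : ℂ) / (((m : ℂ) + 1) * ((m : ℂ) + 11) * ((m : ℂ) + 13))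

/-- `ζ₀(m, c)`. -/
noncomputable def zeta0 (m : ℤ) (c : ℂ) : ℂ :=
  152320 * ((m : ℂ) ^ 3 + 30 * (m : ℂ) ^ 2 + 437 * (m : ℂ) + 2628)
      * ((m + 14).toNat.choose 17 : ℂ)
      / (((m : ℂ) + 1) * ((m : ℂ) + 3) * ((m : ℂ) + 11) * ((m : ℂ) + 13))
    - (3168931 * (m : ℂ) ^ 3 + 41305158 * (m : ℂ) ^ 2 - 26765899 * (m : ℂ) - 366373782)
      * ((m + 14).toNat.choose 16 : ℂ) * c
      / (((m : ℂ) + 2) * ((m : ℂ) + 3) * ((m : ℂ) + 13))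

/-- `ξ₁(m)`. -/
noncomputable def xi1 (m : ℤ) : ℂ :=
  -17821440 * ((m + 14).toNat.choose 17 : ℂ)
    / (((m : ℂ) + 5) * ((m : ℂ) + 7) * ((m : ℂ) + 13))

/-- `ζ₁(m, c)`. -/
noncomputable def zeta1 (m : ℤ) (c : ℂ) : ℂ :=
  (8 / (5 * (Nat.factorial 13 : ℂ)))
      * (13 * (m : ℂ) ^ 6 + 559 * (m : ℂ) ^ 5 + 10914 * (m : ℂ) ^ 4 + 113042 * (m : ℂ) ^ 3
          + 541013 * (m : ℂ) ^ 2 + 743199 * (m : ℂ) + 141660)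
      * ((m : ℂ) - 2) * (m : ℂ) * ((m : ℂ) + 2) * ((m : ℂ) + 4) * ((m : ℂ) + 6)
      * ((m : ℂ) + 7) * ((m : ℂ) + 8) * ((m : ℂ) + 10) * ((m : ℂ) + 12) * ((m : ℂ) + 14)
    - 15 * (1595885 * (m : ℂ) ^ 3 + 18046170 * (m : ℂ) ^ 2 - 32028341 * (m : ℂ) - 411762282)
      * ((m + 14).toNat.choose 16 : ℂ) * c
      / (((m : ℂ) + 2) * ((m : ℂ) + 5) * ((m : ℂ) + 11))

/-- `ξ₂(m)`. -/
noncomputable def xi2 (m : ℤ) : ℂ :=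
  -18670080 * ((m + 14).toNat.choose 17 : ℂ)
    / (((m : ℂ) + 3) * ((m : ℂ) + 9) * ((m : ℂ) + 13))

/-- `ζ₂(m, c)`. -/
noncomputable def zeta2 (m : ℤ) (c : ℂ) : ℂ :=
  (32 / (Nat.factorial 15 : ℂ))
      * (143 * (m : ℂ) ^ 6 + 6435 * (m : ℂ) ^ 5 + 129602 * (m : ℂ) ^ 4
          + 1390950 * (m : ℂ) ^ 3 + 7149347 * (m : ℂ) ^ 2 + 12054375 * (m : ℂ) + 5315868)
      * ((m : ℂ) - 2) * (m : ℂ) * ((m : ℂ) + 2) * ((m : ℂ) + 4) * ((m : ℂ) + 5)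
      * ((m : ℂ) + 6) * ((m : ℂ) + 8) * ((m : ℂ) + 10) * ((m : ℂ) + 12) * ((m : ℂ) + 14)
    - 156 * (152331 * (m : ℂ) ^ 3 + 1559062 * (m : ℂ) ^ 2 - 4454319 * (m : ℂ) - 55321438)
      * ((m + 14).toNat.choose 16 : ℂ) * c
      / (((m : ℂ) + 2) * ((m : ℂ) + 7) * ((m : ℂ) + 9))

theorem aux_choose (t : ℕ) : (((46 + t).choose 17 : ℕ) : ℂ) * 355687428096000 =
    ((t:ℂ)+30)*(t+31)*(t+32)*(t+33)*(t+34)*(t+35)*(t+36)*(t+37)*(t+38)*(t+39)*(t+40)*(t+41)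
      *(t+42)*(t+43)*(t+44)*(t+45)*(t+46) := by
  have h := Nat.descFactorial_eq_factorial_mul_choose (46 + t) 17
  have h2 : (46 + t).descFactorial 17 = (t+30)*(t+31)*(t+32)*(t+33)*(t+34)*(t+35)*(t+36)*(t+37)
      *(t+38)*(t+39)*(t+40)*(t+41)*(t+42)*(t+43)*(t+44)*(t+45)*(t+46) := by
    have e : ∀ a b : ℕ, b ≤ a → a + t - b = t + (a - b) := by intro a b hh; omega
    simp only [Nat.descFactorial_succ, Nat.descFactorial_zero]
    rw [e 46 16 (by norm_num), e 46 15 (by norm_num), e 46 14 (by norm_num), e 46 13 (by norm_num),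
      e 46 12 (by norm_num), e 46 11 (by norm_num), e 46 10 (by norm_num), e 46 9 (by norm_num),
      e 46 8 (by norm_num), e 46 7 (by norm_num), e 46 6 (by norm_num), e 46 5 (by norm_num),
      e 46 4 (by norm_num), e 46 3 (by norm_num), e 46 2 (by norm_num), e 46 1 (by norm_num),
      e 46 0 (by norm_num)]
    norm_num only
    simp only [mul_one, mul_assoc]
  rw [h2] at h
  have h3 : ((Nat.factorial 17 : ℕ) : ℂ) = 355687428096000 := by norm_num [Nat.factorial]
  rw [← h3, mul_comm, ← Nat.cast_mul, ← h]
  simp only [Nat.cast_mul, Nat.cast_add, Nat.cast_ofNat]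

theorem aux_poly (t : ℕ) : (15383220708886537022125155000 + 4521247674323983536294439650 * (t:ℂ) ^ 1 + 608271763633363718043318315 * (t:ℂ) ^ 2 + 49522920763002981140037702 * (t:ℂ) ^ 3 + 2716780085790837226275205 * (t:ℂ) ^ 4 + 105762744805446808130716 * (t:ℂ) ^ 5 + 2994728839234445547110 * (t:ℂ) ^ 6 + 62115702918037324692 * (t:ℂ) ^ 7 + 936130646200593114 * (t:ℂ) ^ 8 + 9990189676567170 * (t:ℂ) ^ 9 + 71600194607327 * (t:ℂ) ^ 10 + 309113528870 * (t:ℂ) ^ 11 + 607127929 * (t:ℂ) ^ 12) ≠ 0 := by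
  have h : (15383220708886537022125155000 + 4521247674323983536294439650 * t ^ 1 + 608271763633363718043318315 * t ^ 2 + 49522920763002981140037702 * t ^ 3 + 2716780085790837226275205 * t ^ 4 + 105762744805446808130716 * t ^ 5 + 2994728839234445547110 * t ^ 6 + 62115702918037324692 * t ^ 7 + 936130646200593114 * t ^ 8 + 9990189676567170 * t ^ 9 + 71600194607327 * t ^ 10 + 309113528870 * t ^ 11 + 607127929 * t ^ 12) ≠ 0 := by positivity
  exact_mod_cast h

theorem aux_lin {S E w X0 X1 X2 a0 a1 a2 b0 b1 b2 : ℂ} (hS : S ≠ 0) (hE : E ≠ 0)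
    (h1 : S * X0 * (E * a1 - w * b1) - S * X1 * (E * a0 - w * b0) = 0)
    (h2 : S * X1 * (E * a2 - w * b2) - S * X2 * (E * a1 - w * b1) = 0)
    (h3 : S * X2 * (E * a0 - w * b0) - S * X0 * (E * a2 - w * b2) = 0) :
    (X0 * a1 - X1 * a0) * b2 + (X1 * a2 - X2 * a1) * b0 + (X2 * a0 - X0 * a2) * b1 = 0 := by
  have : (S * E) * ((X0 * a1 - X1 * a0) * b2 + (X1 * a2 - X2 * a1) * b0
      + (X2 * a0 - X0 * a2) * b1) = 0 := by
    linear_combination b2 * h1 + b0 * h2 + b1 * h3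
  exact (mul_eq_zero.mp this).resolve_left (mul_ne_zero hS hE)

/-- For every even integer `m ≥ 32` and every complex `c`, one of the determinants
`ξ₀ζ₁ - ξ₁ζ₀`, `ξ₁ζ₂ - ξ₂ζ₁`, `ξ₂ζ₀ - ξ₀ζ₂` is nonzero. -/
theorem one_determinant_nonzero (m : ℤ) (hm : 32 ≤ m) (hme : Even m) (c : ℂ) :
    xi0 m * zeta1 m c - xi1 m * zeta0 m c ≠ 0 ∨
      xi1 m * zeta2 m c - xi2 m * zeta1 m c ≠ 0 ∨
        xi2 m * zeta0 m c - xi0 m * zeta2 m c ≠ 0 := by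
  
  obtain ⟨t, rfl⟩ : ∃ t : ℕ, m = 32 + (t : ℤ) := ⟨(m - 32).toNat, by omega⟩
  by_contra hcon
  push Not at hcon
  obtain ⟨h1, h2, h3⟩ := hcon
  have hch := aux_choose t
  have htn : ((32 + (t:ℤ)) + 14).toNat = 46 + t := by omega
  have hp : ∀ k : ℕ, 0 < k → (t:ℂ) + (k:ℂ) ≠ 0 := by
    intro k hk
    have : t + k ≠ 0 := by omega
    exact_mod_cast this
  have hQ := aux_poly t
  set C := (((46 + t).choose 17 : ℕ) : ℂ) with hC
  set B := (((46 + t).choose 16 : ℕ) : ℂ) with hB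
  have hC0 : C ≠ 0 := by
    have : (46 + t).choose 17 ≠ 0 := (Nat.choose_pos (by omega)).ne'
    rw [hC]; exact_mod_cast this
  clear_value C B
  have hx : ((32 + (t:ℤ) : ℤ) : ℂ) = (t:ℂ) + 32 := by push_cast; ring
  have f13 : ((Nat.factorial 13 : ℕ) : ℂ) = 6227020800 := by norm_num [Nat.factorial]
  have f15 : ((Nat.factorial 15 : ℕ) : ℂ) = 1307674368000 := by norm_num [Nat.factorial]
  generalize (32 + (t:ℤ)) = M at *
  generalize (t:ℂ) = x at *
  have n30 : x + 30 ≠ 0 := hp 30 (by norm_num)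
  have n32 : x + 32 ≠ 0 := hp 32 (by norm_num)
  have n33 : x + 33 ≠ 0 := hp 33 (by norm_num)
  have n34 : x + 34 ≠ 0 := hp 34 (by norm_num)
  have n35 : x + 35 ≠ 0 := hp 35 (by norm_num)
  have n36 : x + 36 ≠ 0 := hp 36 (by norm_num)
  have n37 : x + 37 ≠ 0 := hp 37 (by norm_num)
  have n38 : x + 38 ≠ 0 := hp 38 (by norm_num)
  have n39 : x + 39 ≠ 0 := hp 39 (by norm_num)
  have n40 : x + 40 ≠ 0 := hp 40 (by norm_num)
  have n41 : x + 41 ≠ 0 := hp 41 (by norm_num)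
  have n42 : x + 42 ≠ 0 := hp 42 (by norm_num)
  have n43 : x + 43 ≠ 0 := hp 43 (by norm_num)
  have n44 : x + 44 ≠ 0 := hp 44 (by norm_num)
  have n45 : x + 45 ≠ 0 := hp 45 (by norm_num)
  have n46 : x + 46 ≠ 0 := hp 46 (by norm_num)
  have ex0 : xi0 M = (C/((x+45)*(x+33)*(x+43)*(x+37)*(x+39)*(x+35)*(x+41))) * (-2284800*((x+37)*(x+39)*(x+35)*(x+41))) := by
    simp only [xi0, htn, hx, ← hC]
    have e : x + 32 + 0 = x + 32 := by ring
    have e1 : x + 32 + 1 = x + 33 := by ring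
    have e11 : x + 32 + 11 = x + 43 := by ring
    have e13 : x + 32 + 13 = x + 45 := by ring
    rw [e1, e11, e13]
    field_simp
  have ex1 : xi1 M = (C/((x+45)*(x+33)*(x+43)*(x+37)*(x+39)*(x+35)*(x+41))) * (-17821440*((x+33)*(x+43)*(x+35)*(x+41))) := by
    simp only [xi1, htn, hx, ← hC]
    have e : x + 32 + 0 = x + 32 := by ring
    have e5 : x + 32 + 5 = x + 37 := by ring
    have e7 : x + 32 + 7 = x + 39 := by ring
    have e13 : x + 32 + 13 = x + 45 := by ring
    rw [e5, e7, e13]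
    field_simp
  have ex2 : xi2 M = (C/((x+45)*(x+33)*(x+43)*(x+37)*(x+39)*(x+35)*(x+41))) * (-18670080*((x+33)*(x+43)*(x+37)*(x+39))) := by
    simp only [xi2, htn, hx, ← hC]
    have e : x + 32 + 0 = x + 32 := by ring
    have e3 : x + 32 + 3 = x + 35 := by ring
    have e9 : x + 32 + 9 = x + 41 := by ring
    have e13 : x + 32 + 13 = x + 45 := by ring
    rw [e3, e9, e13]
    field_simp
  have ez0 : zeta0 M c = ((x+30)*(x+32)*(x+34)*(x+36)*(x+38)*(x+40)*(x+42)*(x+44)*(x+46)) * (152320/355687428096000*((1)*(x+32)^3 + (30)*(x+32)^2 + (437)*(x+32)^1 + (2628)*(x+32)^0)*((x+31)*(x+37)*(x+39)*(x+41))) - (B*c/((x+34)*(x+35)*(x+45)*(x+37)*(x+43)*(x+39)*(x+41))) * (((3168931)*(x+32)^3 + (41305158)*(x+32)^2 + (-26765899)*(x+32)^1 + (-366373782)*(x+32)^0)*((x+37)*(x+43)*(x+39)*(x+41))) := by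
    simp only [zeta0, htn, hx, ← hC, ← hB, f13, f15]
    have hC' : C = ((x+30)*(x+32)*(x+34)*(x+36)*(x+38)*(x+40)*(x+42)*(x+44)*(x+46)) * ((x+31)*(x+33)*(x+35)*(x+37)*(x+39)*(x+41)*(x+43)*(x+45)) / 355687428096000 := by
      rw [eq_div_iff (by norm_num), hch]; ring
    rw [hC']
    have e1 : x + 32 + 1 = x + 33 := by ring
    have e2 : x + 32 + 2 = x + 34 := by ring
    have e3 : x + 32 + 3 = x + 35 := by ring
    have e11 : x + 32 + 11 = x + 43 := by ring
    have e13 : x + 32 + 13 = x + 45 := by ring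
    simp only [e1, e2, e3, e11, e13]
    congr 1
    · field_simp
    · field_simp
      ring
  have ez1 : zeta1 M c = ((x+30)*(x+32)*(x+34)*(x+36)*(x+38)*(x+40)*(x+42)*(x+44)*(x+46)) * (8/(5*6227020800)*((13)*(x+32)^6 + (559)*(x+32)^5 + (10914)*(x+32)^4 + (113042)*(x+32)^3 + (541013)*(x+32)^2 + (743199)*(x+32)^1 + (141660)*(x+32)^0)*(x+39)) - (B*c/((x+34)*(x+35)*(x+45)*(x+37)*(x+43)*(x+39)*(x+41))) * (15*((1595885)*(x+32)^3 + (18046170)*(x+32)^2 + (-32028341)*(x+32)^1 + (-411762282)*(x+32)^0)*((x+35)*(x+45)*(x+39)*(x+41))) := by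
    simp only [zeta1, htn, hx, ← hC, ← hB, f13, f15]
    have e2 : x + 32 + 2 = x + 34 := by ring
    have e5 : x + 32 + 5 = x + 37 := by ring
    have e11 : x + 32 + 11 = x + 43 := by ring
    simp only [e2, e5, e11]
    congr 1
    · ring
    · field_simp
      ring
  have ez2 : zeta2 M c = ((x+30)*(x+32)*(x+34)*(x+36)*(x+38)*(x+40)*(x+42)*(x+44)*(x+46)) * (32/1307674368000*((143)*(x+32)^6 + (6435)*(x+32)^5 + (129602)*(x+32)^4 + (1390950)*(x+32)^3 + (7149347)*(x+32)^2 + (12054375)*(x+32)^1 + (5315868)*(x+32)^0)*(x+37)) - (B*c/((x+34)*(x+35)*(x+45)*(x+37)*(x+43)*(x+39)*(x+41))) * (156*((152331)*(x+32)^3 + (1559062)*(x+32)^2 + (-4454319)*(x+32)^1 + (-55321438)*(x+32)^0)*((x+35)*(x+45)*(x+37)*(x+43))) := by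
    simp only [zeta2, htn, hx, ← hC, ← hB, f13, f15]
    have e2 : x + 32 + 2 = x + 34 := by ring
    have e7 : x + 32 + 7 = x + 39 := by ring
    have e9 : x + 32 + 9 = x + 41 := by ring
    simp only [e2, e7, e9]
    congr 1
    · ring
    · field_simp
      ring
  rw [ex0, ex1, ez0, ez1] at h1
  rw [ex1, ex2, ez1, ez2] at h2
  rw [ex2, ex0, ez2, ez0] at h3
  have hS : (C/((x+45)*(x+33)*(x+43)*(x+37)*(x+39)*(x+35)*(x+41))) ≠ 0 := div_ne_zero hC0 (by simp [*])
  have hE : ((x+30)*(x+32)*(x+34)*(x+36)*(x+38)*(x+40)*(x+42)*(x+44)*(x+46)) ≠ 0 := by simp [*]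
  have hd := aux_lin hS hE h1 h2 h3
  refine mul_ne_zero (mul_ne_zero (mul_ne_zero (mul_ne_zero (mul_ne_zero
    (show (544/2027025 : ℂ) ≠ 0 by norm_num) n41) n39) n37) n37) hQ ?_
  rw [← hd]
  ring
end

section
/- Define xi_k and zeta_k (k = 0, 1, 2) as functions of an integer m and a complex number c by: xi_0 = -2284800 * C(m+14,17) / ((m+1)(m+11)(m+13)); zeta_0 = 152320*(m^3+30m^2+437m+2628) * C(m+14,17) / ((m+1)(m+3)(m+11)(m+13)) - (3168931 m^3 + 41305158 m^2 - 26765899 m - 366373782) * C(m+14,16) * c / ((m+2)(m+3)(m+13)); xi_1 = -17821440 * C(m+14,17) / ((m+5)(m+7)(m+13)); zeta_1 = (8/(5*13!)) * (13 m^6 + 559 m^5 + 10914 m^4 + 113042 m^3 + 541013 m^2 + 743199 m + 141660) * (m-2) * m * (m+2) * (m+4) * (m+6) * (m+7) * (m+8) * (m+10) * (m+12) * (m+14) - 15*(1595885 m^3 + 18046170 m^2 - 32028341 m - 411762282) * C(m+14,16) * c / ((m+2)(m+5)(m+11)); xi_2 = -18670080 * C(m+14,17) / ((m+3)(m+9)(m+13));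 zeta_2 = (32/15!) * (143 m^6 + 6435 m^5 + 129602 m^4 + 1390950 m^3 + 7149347 m^2 + 12054375 m + 5315868) * (m-2) * m * (m+2) * (m+4) * (m+5) * (m+6) * (m+8) * (m+10) * (m+12) * (m+14) - 156*(152331 m^3 + 1559062 m^2 - 4454319 m - 55321438) * C(m+14,16) * c / ((m+2)(m+7)(m+9)). Then for every even integer m >= 32, every complex number c, and all complex numbers A, B: if xi_k * A + zeta_k * B = 0 for all k = 0, 1, 2, then A = 0 and B = 0. -/
theorem aux_elim (x A B C : ℂ)
    (R0 : -2284800 * ((x+2)*(x+3)) * A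
      + 152320 * (x^3+30*x^2+437*x+2628) * (x+2) * B
      - (3168931*x^3+41305158*x^2-26765899*x-366373782)*((x+1)*(x+11)) * C = 0)
    (R1 : -17821440 * ((x-1)*(x+1)*(x+2)*(x+3)*(x+9)*(x+11)) * A
      + 91392 * (13*x^6+559*x^5+10914*x^4+113042*x^3+541013*x^2+743199*x+141660) * ((x+2)*(x+7)) * B
      - 15*(1595885*x^3+18046170*x^2-32028341*x-411762282)*((x-1)*(x+1)*(x+3)*(x+7)*(x+9)*(x+13)) * C = 0)
    (R2 : -18670080 * ((x-1)*(x+1)*(x+2)*(x+7)*(x+11)) * A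
      + 8704 * (143*x^6+6435*x^5+129602*x^4+1390950*x^3+7149347*x^2+12054375*x+5315868) * (x+2) * B
      - 156*(152331*x^3+1559062*x^2-4454319*x-55321438)*((x-1)*(x+1)*(x+3)*(x+11)*(x+13)) * C = 0) :
    (x+2)^2*(x+1)*(x-1) * (607127929*x^12 + 75976404134*x^11 + 3824366398623*x^10
      + 110640393137090*x^9 + 2129476806026394*x^8 + 29276039805503892*x^7
      + 294702891161539814*x^6 + 2133858516689098780*x^5 + 10398267673484462085*x^4
      + 29605824075175173574*x^3 + 34177712354723894763*x^2 - 12000716977948923870*x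
      - 30796479542609776008) * B = 0 := by
  have e : (95457116160 : ℂ) ≠ 0 := by norm_num
  refine (mul_eq_zero.1 ?_).resolve_left e
  linear_combination
    ((-17821440 * ((x-1)*(x+1)*(x+2)*(x+3)*(x+9)*(x+11))) * (- 156*(152331*x^3+1559062*x^2-4454319*x-55321438)*((x-1)*(x+1)*(x+3)*(x+11)*(x+13))) - (-18670080 * ((x-1)*(x+1)*(x+2)*(x+7)*(x+11))) * (- 15*(1595885*x^3+18046170*x^2-32028341*x-411762282)*((x-1)*(x+1)*(x+3)*(x+7)*(x+9)*(x+13)))) * R0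
    - ((-2284800 * ((x+2)*(x+3))) * (- 156*(152331*x^3+1559062*x^2-4454319*x-55321438)*((x-1)*(x+1)*(x+3)*(x+11)*(x+13))) - (-18670080 * ((x-1)*(x+1)*(x+2)*(x+7)*(x+11))) * (- (3168931*x^3+41305158*x^2-26765899*x-366373782)*((x+1)*(x+11)))) * R1
    + ((-2284800 * ((x+2)*(x+3))) * (- 15*(1595885*x^3+18046170*x^2-32028341*x-411762282)*((x-1)*(x+1)*(x+3)*(x+7)*(x+9)*(x+13))) - (-17821440 * ((x-1)*(x+1)*(x+2)*(x+3)*(x+9)*(x+11))) * (- (3168931*x^3+41305158*x^2-26765899*x-366373782)*((x+1)*(x+11)))) * R2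

theorem aux_poly_s8 (n : ℕ) : ∀ x : ℂ, x = (n : ℂ) + 32 →
    (607127929*x^12 + 75976404134*x^11 + 3824366398623*x^10
      + 110640393137090*x^9 + 2129476806026394*x^8 + 29276039805503892*x^7
      + 294702891161539814*x^6 + 2133858516689098780*x^5 + 10398267673484462085*x^4
      + 29605824075175173574*x^3 + 34177712354723894763*x^2 - 12000716977948923870*x
      - 30796479542609776008) ≠ 0 := by
  rintro x rfl
  have : 607127929*n^12 + 309113528870*n^11 + 71600194607327*n^10 + 9990189676567170*n^9
    + 936130646200593114*n^8 + 62115702918037324692*n^7 + 2994728839234445547110*n^6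
    + 105762744805446808130716*n^5 + 2716780085790837226275205*n^4
    + 49522920763002981140037702*n^3 + 608271763633363718043318315*n^2
    + 4521247674323983536294439650*n + 15383220708886537022125155000 ≠ 0 := by positivity
  have h2 : ((607127929*n^12 + 309113528870*n^11 + 71600194607327*n^10 + 9990189676567170*n^9
    + 936130646200593114*n^8 + 62115702918037324692*n^7 + 2994728839234445547110*n^6
    + 105762744805446808130716*n^5 + 2716780085790837226275205*n^4
    + 49522920763002981140037702*n^3 + 608271763633363718043318315*n^2
    + 4521247674323983536294439650*n + 15383220708886537022125155000 : ℕ) : ℂ) ≠ 0 :=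
    Nat.cast_ne_zero.2 this
  push_cast at h2
  intro h
  apply h2
  linear_combination h

theorem system_only_trivial_solution (m : ℤ) (hm : 32 ≤ m) (hme : Even m) (c : ℂ)
    (A B : ℂ)
    (h0 : xi0 m * A + zeta0 m c * B = 0)
    (h1 : xi1 m * A + zeta1 m c * B = 0)
    (h2 : xi2 m * A + zeta2 m c * B = 0) :
    A = 0 ∧ B = 0 := by
  obtain ⟨n, hn⟩ := Int.eq_ofNat_of_zero_le (sub_nonneg.2 hm)
  obtain rfl : m = (n : ℤ) + 32 := by omega
  have ht : ((n : ℤ) + 32 + 14).toNat = n + 46 := by omega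
  unfold xi0 zeta0 at h0
  unfold xi1 zeta1 at h1
  unfold xi2 zeta2 at h2
  rw [ht] at h0 h1 h2
  have hx : (((n : ℤ) + 32 : ℤ) : ℂ) = (n : ℂ) + 32 := by push_cast; rfl
  have hD := Nat.ascFactorial_eq_factorial_mul_choose (n+29) 17
  have hE := Nat.ascFactorial_eq_factorial_mul_choose (n+30) 16
  rw [show n + 29 + 17 = n + 46 by ring] at hD
  rw [show n + 30 + 16 = n + 46 by ring] at hE
  have hD0 : (((n+46).choose 17 : ℕ) : ℂ) ≠ 0 :=
    Nat.cast_ne_zero.2 (Nat.choose_pos (by omega)).ne'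
  have hD := congrArg (Nat.cast : ℕ → ℂ) hD
  have hE := congrArg (Nat.cast : ℕ → ℂ) hE
  have nz : ∀ k : ℕ, (n : ℂ) + 32 + k ≠ 0 := fun k => by
    have : n + 32 + k ≠ 0 := by omega
    exact_mod_cast this
  have nm1 : (n : ℂ) + 32 - 1 ≠ 0 := by
    have : ((n + 31 : ℕ) : ℂ) ≠ 0 := Nat.cast_ne_zero.2 (by omega)
    intro h; apply this; push_cast; linear_combination h
  have nm2 : (n : ℂ) + 32 - 2 ≠ 0 := by
    have : ((n + 30 : ℕ) : ℂ) ≠ 0 := Nat.cast_ne_zero.2 (by omega)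
    intro h; apply this; push_cast; linear_combination h
  have hp := aux_poly_s8 n _ rfl
  simp only [Nat.ascFactorial_succ, Nat.ascFactorial_zero] at hD hE
  push_cast at hD hE
  rw [hx] at h0 h1 h2
  generalize (((n+46).choose 17 : ℕ) : ℂ) = D at *
  generalize (((n+46).choose 16 : ℕ) : ℂ) = E at *
  obtain ⟨x, hxx⟩ : ∃ x : ℂ, x = (n : ℂ) + 32 := ⟨_, rfl⟩
  have hnx : (n : ℂ) = x - 32 := by rw [hxx]; ring
  rw [← hxx] at h0 h1 h2 nm1 nm2 hp nz
  rw [hnx] at hD hE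
  have f17 : (Nat.factorial 17 : ℂ) = 355687428096000 := by norm_num [Nat.factorial]
  have f16 : (Nat.factorial 16 : ℂ) = 20922789888000 := by norm_num [Nat.factorial]
  have f13 : (Nat.factorial 13 : ℂ) = 6227020800 := by norm_num [Nat.factorial]
  have f15 : (Nat.factorial 15 : ℂ) = 1307674368000 := by norm_num [Nat.factorial]
  rw [f17] at hD
  rw [f16] at hE
  rw [f13] at h1
  rw [f15] at h2
  have n1 := nz 1
  have n2 := nz 2
  have n3 := nz 3
  have n5 := nz 5
  have n7 := nz 7
  have n9 := nz 9
  have n11 := nz 11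
  have n13 := nz 13
  push_cast at n1 n2 n3 n5 n7 n9 n11 n13
  have hD' : (x-2)*x*(x+2)*(x+4)*(x+6)*(x+8)*(x+10)*(x+12)*(x+14)
      = 355687428096000 * D / ((x-1)*(x+1)*(x+3)*(x+5)*(x+7)*(x+9)*(x+11)*(x+13)) := by
    field_simp
    linear_combination hD
  have hE' : E = 17 * D / (x-2) := by
    field_simp
    refine mul_left_cancel₀ (show (20922789888000:ℂ) ≠ 0 by norm_num) ?_
    linear_combination hD - (x-2) * hE
  clear hD hE
  have R0 : -2284800 * ((x+2)*(x+3)) * A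
      + 152320 * (x^3+30*x^2+437*x+2628) * (x+2) * B
      - (3168931*x^3+41305158*x^2-26765899*x-366373782)*((x+1)*(x+11)) * (17*c*B/(x-2)) = 0 := by
    rw [hE'] at h0
    refine (mul_eq_zero.1 (?_ : D / ((x+1)*(x+2)*(x+3)*(x+11)*(x+13)) * _ = 0)).resolve_left
      (by positivity)
    rw [← h0]
    field_simp
    ring
  have R1 : -17821440 * ((x-1)*(x+1)*(x+2)*(x+3)*(x+9)*(x+11)) * A
      + 91392 * (13*x^6+559*x^5+10914*x^4+113042*x^3+541013*x^2+743199*x+141660) * ((x+2)*(x+7)) * B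
      - 15*(1595885*x^3+18046170*x^2-32028341*x-411762282)*((x-1)*(x+1)*(x+3)*(x+7)*(x+9)*(x+13)) * (17*c*B/(x-2)) = 0 := by
    refine (mul_eq_zero.1 (?_ : D / ((x-1)*(x+1)*(x+2)*(x+3)*(x+5)*(x+7)*(x+9)*(x+11)*(x+13)) * _ = 0)).resolve_left
      (by positivity)
    rw [← h1, hE']
    have : ∀ P : ℂ, 8 / (5 * 6227020800) * P * (x-2)*x*(x+2)*(x+4)*(x+6)*(x+7)*(x+8)*(x+10)*(x+12)*(x+14)
      = 8 / (5 * 6227020800) * P * (x+7) * (355687428096000 * D / ((x-1)*(x+1)*(x+3)*(x+5)*(x+7)*(x+9)*(x+11)*(x+13))) := by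
      intro P; rw [← hD']; ring
    rw [this]
    field_simp
    ring
  have R2 : -18670080 * ((x-1)*(x+1)*(x+2)*(x+7)*(x+11)) * A
      + 8704 * (143*x^6+6435*x^5+129602*x^4+1390950*x^3+7149347*x^2+12054375*x+5315868) * (x+2) * B
      - 156*(152331*x^3+1559062*x^2-4454319*x-55321438)*((x-1)*(x+1)*(x+3)*(x+11)*(x+13)) * (17*c*B/(x-2)) = 0 := by
    refine (mul_eq_zero.1 (?_ : D / ((x-1)*(x+1)*(x+2)*(x+3)*(x+7)*(x+9)*(x+11)*(x+13)) * _ = 0)).resolve_left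
      (by positivity)
    rw [← h2, hE']
    have : ∀ P : ℂ, 32 / 1307674368000 * P * (x-2)*x*(x+2)*(x+4)*(x+5)*(x+6)*(x+8)*(x+10)*(x+12)*(x+14)
      = 32 / 1307674368000 * P * (x+5) * (355687428096000 * D / ((x-1)*(x+1)*(x+3)*(x+5)*(x+7)*(x+9)*(x+11)*(x+13))) := by
      intro P; rw [← hD']; ring
    rw [this]
    field_simp
    ring
  have hB := aux_elim x A B _ R0 R1 R2
  have hB0 : B = 0 := by
    refine (mul_eq_zero.1 hB).resolve_left (mul_ne_zero ?_ hp)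
    exact mul_ne_zero (mul_ne_zero (pow_ne_zero _ n2) n1) nm1
  refine ⟨?_, hB0⟩
  rw [hB0] at R0
  refine (mul_eq_zero.1 (show (-2284800 * ((x+2)*(x+3))) * A = 0 by linear_combination R0)).resolve_left ?_
  exact mul_ne_zero (by norm_num) (mul_ne_zero n2 n3)
end
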